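/- For every real ε > 0 there exist η > 0 and C > 0, depending only on ε, with the following property. Let p be a prime, let H be an integer with 1 ≤ H ≤ p, let 𝓜 ⊆ 𝔽_p^* be a set of cardinality M, and suppose that either (i) H ≥ p^{2/3} and H·M ≥ p^{1+ε}, or (ii) H < p^{2/3}, M ≥ p^{1/3}, and H·M^{1/4} ≥ p^{3/4+ε}. Then the product set 𝓗𝓜 = { h·m mod p : 1 ≤ h ≤ H, m ∈ 𝓜 } satisfies |#(𝓗𝓜) − p| ≤ C·p^{1−η}; in particular #(𝓗𝓜) ≥ p − C·p^{1−η}. -/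

import Mathlib

open Finset

lemma divisor_bound (δ : ℝ) (hδ : 0 < δ) : ∃ C : ℝ, 1 ≤ C ∧ ∀ n : ℕ, n ≠ 0 →
    ((n.divisors.card : ℕ) : ℝ) ≤ C * (n : ℝ) ^ δ := by
  set K : ℝ := max 1 (1 / (δ * Real.log 2)) with hK
  have hl2 : 0 < Real.log 2 := Real.log_pos (by norm_num)
  have hK1 : 1 ≤ K := le_max_left _ _
  have hK2 : 1 ≤ K * (δ * Real.log 2) := by
    have : 1 / (δ * Real.log 2) ≤ K := le_max_right _ _
    rwa [div_le_iff₀ (by positivity)] at this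
  set P : ℕ := ⌈(2:ℝ) ^ (1 / δ)⌉₊ with hP
  refine ⟨K ^ P, one_le_pow₀ hK1, fun n hn => ?_⟩
  rw [Nat.card_divisors hn]
  have hnpow : (n : ℝ) ^ δ = ∏ q ∈ n.primeFactors, ((q : ℝ) ^ (n.factorization q)) ^ δ := by
    conv_lhs => rw [← Nat.prod_factorization_pow_eq_self hn]
    rw [Finsupp.prod, Nat.support_factorization]
    push_cast
    rw [Real.finsetProd_rpow]
    intro i _; positivity
  have hterm : ∀ q ∈ n.primeFactors, ((n.factorization q + 1 : ℕ) : ℝ) ≤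
      (if q < P then K else 1) * ((q : ℝ) ^ (n.factorization q)) ^ δ := by
    intro q hq
    have hqp := Nat.prime_of_mem_primeFactors hq
    set a := n.factorization q
    have hq2 : (2:ℝ) ≤ q := by exact_mod_cast hqp.two_le
    split_ifs with h
    · have h1 : ((2:ℝ) ^ a) ^ δ ≤ ((q : ℝ) ^ a) ^ δ := by gcongr
      have h2 : 1 + a * (δ * Real.log 2) ≤ ((2:ℝ) ^ a) ^ δ := by
        rw [← Real.rpow_natCast, ← Real.rpow_mul (by norm_num), Real.rpow_def_of_pos (by norm_num)]
        have := Real.add_one_le_exp (Real.log 2 * (a * δ))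
        linarith
      push_cast
      have h3 : (a:ℝ) + 1 ≤ K * (1 + a * (δ * Real.log 2)) := by
        have : (a:ℝ) * 1 ≤ a * (K * (δ * Real.log 2)) := by gcongr
        nlinarith
      calc (a:ℝ) + 1 ≤ K * (1 + a * (δ * Real.log 2)) := h3
        _ ≤ K * ((q : ℝ) ^ a) ^ δ := by
          apply mul_le_mul_of_nonneg_left (h2.trans h1) (by linarith)
    · have hq' : (2:ℝ) ^ (1 / δ) ≤ q := (Nat.le_ceil _).trans (by exact_mod_cast not_lt.1 h)
      have h1 : (2:ℝ) ≤ (q:ℝ) ^ δ := by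
        have := Real.rpow_le_rpow (by positivity) hq' hδ.le
        rwa [← Real.rpow_mul (by norm_num), one_div_mul_cancel hδ.ne', Real.rpow_one] at this
      have h2 : ((q : ℝ) ^ a) ^ δ = ((q:ℝ) ^ δ) ^ a := by
        rw [← Real.rpow_natCast, ← Real.rpow_natCast, ← Real.rpow_mul (by positivity),
          ← Real.rpow_mul (by positivity), mul_comm]
      rw [h2, one_mul]
      calc ((a + 1 : ℕ) : ℝ) ≤ ((2 ^ a : ℕ) : ℝ) := by exact_mod_cast Nat.lt_two_pow_self
        _ = (2:ℝ) ^ a := by push_cast; rfl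
        _ ≤ _ := by gcongr
  push_cast
  calc ∏ q ∈ n.primeFactors, ((n.factorization q : ℝ) + 1)
      ≤ ∏ q ∈ n.primeFactors, ((if q < P then K else 1) * ((q : ℝ) ^ (n.factorization q)) ^ δ) := by
        apply Finset.prod_le_prod
        · intro i _; positivity
        · intro i hi; exact_mod_cast hterm i hi
    _ = (∏ q ∈ n.primeFactors, (if q < P then K else 1)) * (n : ℝ) ^ δ := by
        rw [Finset.prod_mul_distrib, hnpow]
    _ ≤ K ^ P * (n : ℝ) ^ δ := by
        gcongr
        rw [Finset.prod_ite, Finset.prod_const, Finset.prod_const, one_pow, mul_one]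
        apply pow_le_pow_right₀ hK1
        calc _ ≤ (Finset.range P).card := by
              apply Finset.card_le_card
              intro x hx
              simp at hx ⊢; exact hx.2
          _ = P := by simp

/-- Nonzero integers of absolute value at most `B`. -/
noncomputable def nzI (B : ℕ) : Finset ℤ := (Finset.Icc (-(B:ℤ)) B).erase 0

lemma mem_nzI {B : ℕ} {k : ℤ} : k ∈ nzI B ↔ k ≠ 0 ∧ |k| ≤ B := by
  simp [nzI, abs_le]

lemma rep_card (B : ℕ) (n : ℤ) (hn : n ≠ 0) :
    ((nzI B ×ˢ nzI B).filter (fun x => x.1 * x.2 = n)).card ≤ 2 * n.natAbs.divisors.card := by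
  have h : ((nzI B ×ˢ nzI B).filter (fun x => x.1 * x.2 = n)).card ≤
      (({1, -1} : Finset ℤ) ×ˢ n.natAbs.divisors).card := by
    apply Finset.card_le_card_of_injOn (fun x => (x.1.sign, x.1.natAbs))
    · intro x hx
      simp only [coe_filter, mem_product, Set.mem_ofPred_eq, mem_nzI] at hx
      obtain ⟨⟨⟨h1, _⟩, _⟩, h2⟩ := hx
      simp only [coe_product, Set.mem_prod, mem_coe, Nat.mem_divisors, mem_insert, mem_singleton]
      refine ⟨?_, ?_, by simpa using hn⟩
      · rcases lt_or_gt_of_ne h1 with h | h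
        · right; exact Int.sign_eq_neg_one_of_neg h
        · left; exact Int.sign_eq_one_of_pos h
      · rw [← h2, Int.natAbs_mul]; exact Dvd.intro _ rfl
    · intro x hx y hy hxy
      simp only [coe_filter, mem_product, Set.mem_ofPred_eq, mem_nzI] at hx hy
      simp only [Prod.mk.injEq] at hxy
      have h1 : x.1 = y.1 := by
        rw [← Int.sign_mul_natAbs x.1, ← Int.sign_mul_natAbs y.1, hxy.1, hxy.2]
      have h2 : x.1 * x.2 = x.1 * y.2 := by rw [hx.2]; conv_rhs => rw [h1, hy.2]
      exact Prod.ext h1 (mul_left_cancel₀ hx.1.1.1 h2)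
  rw [card_product] at h
  simpa using h

/-- Number of solutions of the multiplicative equation with nonzero coefficients at most N. -/
noncomputable def Jr (p : ℕ) (m m' : ZMod p) (N : ℕ) : ℕ :=
  ((nzI N ×ˢ nzI N).filter (fun x => (x.1 : ZMod p) * m = (x.2 : ZMod p) * m')).card

lemma Jr_comm (p : ℕ) (m m' : ZMod p) (N : ℕ) : Jr p m m' N = Jr p m' m N := by
  unfold Jr
  apply Finset.card_bij (fun x _ => (x.2, x.1))
  · intro x hx
    simp only [mem_filter, mem_product] at hx ⊢
    exact ⟨⟨hx.1.2, hx.1.1⟩, hx.2.symm⟩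
  · intro x _ y _ h
    simp only [Prod.mk.injEq] at h
    exact Prod.ext h.2 h.1
  · intro x hx
    simp only [mem_filter, mem_product] at hx
    exact ⟨(x.2, x.1), by simp only [mem_filter, mem_product]; exact ⟨⟨hx.1.2, hx.1.1⟩, hx.2.symm⟩, rfl⟩

lemma lattice_aux (p : ℕ) [Fact p.Prime] (m m' : ZMod p) (hm' : m' ≠ 0) (N s : ℕ) (hs : 0 < s)
    (u1 u2 : ℤ) (hu : (u1 : ZMod p) * m = (u2 : ZMod p) * m') (hu1 : |u1| = s) (hu2 : |u2| ≤ s)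
    (hmin : ∀ v1 v2 : ℤ, (v1 : ZMod p) * m = (v2 : ZMod p) * m' → |v1| < s → |v2| < s →
      v1 = 0 ∧ v2 = 0) :
    Jr p m m' N ≤ (2 * (2 * s * N / p) + 1) * (2 * (N / s) + 2) := by
  have hp : 0 < p := (Fact.out : p.Prime).pos
  have hdet : ∀ v1 v2 : ℤ, (v1 : ZMod p) * m = (v2 : ZMod p) * m' → (p : ℤ) ∣ u1 * v2 - u2 * v1 := by
    intro v1 v2 hv
    rw [← ZMod.intCast_zmod_eq_zero_iff_dvd]
    push_cast
    have : ((u1 : ZMod p) * v2 - u2 * v1) * m' = 0 := by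
      linear_combination (-(u1 : ZMod p)) * hv + (v1 : ZMod p) * hu
    exact (mul_eq_zero.1 this).resolve_right hm'
  set a : ℕ := 2 * s * N / p with ha
  set b : ℕ := N / s with hb
  have hcard : ((Finset.Icc (-(a:ℤ)) a) ×ˢ (Finset.Icc (-(b:ℤ) - 1) b)).card =
      (2 * a + 1) * (2 * b + 2) := by
    rw [card_product, Int.card_Icc, Int.card_Icc]
    congr 1 <;> omega
  rw [← hcard]
  unfold Jr
  have hs' : (0:ℤ) < s := by exact_mod_cast hs
  have hp' : (0:ℤ) < p := by exact_mod_cast hp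
  apply Finset.card_le_card_of_injOn (fun v => ((u1 * v.2 - u2 * v.1) / (p:ℤ), v.1 / (s:ℤ)))
  · intro v hv
    simp only [coe_filter, mem_product, Set.mem_ofPred_eq, mem_nzI] at hv
    obtain ⟨⟨⟨_, hv1⟩, ⟨_, hv2⟩⟩, hv⟩ := hv
    obtain ⟨k, hk⟩ := hdet _ _ hv
    simp only [coe_product, Set.mem_prod, mem_coe, Finset.mem_Icc]
    constructor
    · rw [hk, Int.mul_ediv_cancel_left _ hp'.ne', ← abs_le]
      have h1 : |u1 * v.2 - u2 * v.1| ≤ 2 * s * N := by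
        calc |u1 * v.2 - u2 * v.1| ≤ |u1 * v.2| + |u2 * v.1| := abs_sub _ _
          _ = |u1| * |v.2| + |u2| * |v.1| := by rw [abs_mul, abs_mul]
          _ ≤ s * N + s * N := by
            rw [hu1]; gcongr
          _ = _ := by ring
      rw [hk, abs_mul, abs_of_pos hp'] at h1
      rw [ha]
      push_cast
      rw [Int.le_ediv_iff_mul_le hp']
      linarith
    · rw [abs_le] at hv1
      constructor
      · rw [Int.le_ediv_iff_mul_le hs']
        have h2 : (N:ℤ) < (b + 1) * s := by
          have := Nat.lt_mul_div_succ N hs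
          rw [mul_comm] at this
          exact_mod_cast this
        nlinarith
      · rw [hb]; push_cast
        exact Int.ediv_le_ediv hs' hv1.2
  · intro v hv w hw hvw
    simp only [coe_filter, mem_product, Set.mem_ofPred_eq, mem_nzI] at hv hw
    simp only [Prod.mk.injEq] at hvw
    obtain ⟨hd, hq⟩ := hvw
    have hd' : u1 * v.2 - u2 * v.1 = u1 * w.2 - u2 * w.1 := by
      rw [← Int.ediv_mul_cancel (hdet _ _ hv.2), ← Int.ediv_mul_cancel (hdet _ _ hw.2), hd]
    have h1 : |v.1 - w.1| < s := by
      have e1 := Int.emod_add_mul_ediv v.1 s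
      have e2 := Int.emod_add_mul_ediv w.1 s
      rw [hq] at e1
      have f1 := Int.emod_nonneg v.1 hs'.ne'
      have f2 := Int.emod_nonneg w.1 hs'.ne'
      have f3 := Int.emod_lt_of_pos v.1 hs'
      have f4 := Int.emod_lt_of_pos w.1 hs'
      rw [abs_lt]; constructor <;> linarith
    have h2 : |v.2 - w.2| < s := by
      have h3 : u1 * (v.2 - w.2) = u2 * (v.1 - w.1) := by linarith
      have h4 : |u1| * |v.2 - w.2| = |u2| * |v.1 - w.1| := by rw [← abs_mul, ← abs_mul, h3]
      rw [hu1] at h4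
      have h5 : (s:ℤ) * |v.2 - w.2| ≤ s * |v.1 - w.1| := by rw [h4]; gcongr
      exact (le_of_mul_le_mul_left h5 hs').trans_lt h1
    have h3 := hmin (v.1 - w.1) (v.2 - w.2) (by
      push_cast; linear_combination hv.2 - hw.2) h1 h2
    exact Prod.ext (by linarith [h3.1]) (by linarith [h3.2])

set_option maxHeartbeats 1000000 in
lemma lattice_bound (p : ℕ) [Fact p.Prime] (m m' : ZMod p) (hm : m ≠ 0) (hm' : m' ≠ 0) (B : ℕ)
    (hBp : B < p) :
    (Jr p m m' (B ^ 2) : ℝ) ≤ 16 * (B:ℝ) ^ 4 / p + 8 * B * Jr p m m' B + 4 * B := by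
  classical
  have hp : 0 < p := (Fact.out : p.Prime).pos
  by_cases h0 : Jr p m m' (B ^ 2) = 0
  · rw [h0]; push_cast; positivity
  obtain ⟨v, hv⟩ := Finset.card_ne_zero.1 h0
  simp only [mem_filter, mem_product, mem_nzI] at hv
  have hex' : ∃ s : ℕ, ∃ u1 u2 : ℤ, (u1 ≠ 0 ∨ u2 ≠ 0) ∧ (u1 : ZMod p) * m = (u2 : ZMod p) * m' ∧
      s = max u1.natAbs u2.natAbs := ⟨_, v.1, v.2, Or.inl hv.1.1.1, hv.2, rfl⟩
  set s := Nat.find hex' with hsdef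
  obtain ⟨u1, u2, hune, hu, hs⟩ := Nat.find_spec hex'
  rw [← hsdef] at hs
  have hmin : ∀ v1 v2 : ℤ, (v1 : ZMod p) * m = (v2 : ZMod p) * m' → |v1| < s → |v2| < s →
      v1 = 0 ∧ v2 = 0 := by
    intro v1 v2 h h1 h2
    by_contra hcon
    have := Nat.find_min' hex' ⟨v1, v2, by tauto, h, rfl⟩
    rw [← hsdef] at this
    rw [Int.abs_eq_natAbs] at h1 h2
    omega
  have hs0 : 0 < s := by omega
  have hsN : s ≤ B ^ 2 := by
    have := Nat.find_min' hex' ⟨v.1, v.2, Or.inl hv.1.1.1, hv.2, rfl⟩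
    rw [← hsdef] at this
    have h1 := hv.1.1.2
    have h2 := hv.1.2.2
    rw [Int.abs_eq_natAbs] at h1 h2
    omega
  have hmain : Jr p m m' (B ^ 2) ≤ (2 * (2 * s * (B ^ 2) / p) + 1) * (2 * ((B ^ 2) / s) + 2) := by
    by_cases hc : u2.natAbs ≤ u1.natAbs
    · exact lattice_aux p m m' hm' _ s hs0 u1 u2 hu (by rw [Int.abs_eq_natAbs]; omega) (by rw [Int.abs_eq_natAbs]; omega) hmin
    · rw [Jr_comm]
      exact lattice_aux p m' m hm _ s hs0 u2 u1 hu.symm (by rw [Int.abs_eq_natAbs]; omega) (by rw [Int.abs_eq_natAbs]; omega)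
        (fun v1 v2 h h1 h2 => (hmin v2 v1 h.symm h2 h1).symm)
  have hsR : (0:ℝ) < s := by exact_mod_cast hs0
  have hpR : (0:ℝ) < p := by exact_mod_cast hp
  have hmainR : (Jr p m m' (B ^ 2) : ℝ) ≤ 16 * (B:ℝ) ^ 4 / p + 4 * (B:ℝ) ^ 2 / s := by
    have e1 : ((2 * s * (B ^ 2) / p : ℕ) : ℝ) ≤ 2 * s * (B:ℝ) ^ 2 / p := by
      refine Nat.cast_div_le.trans (le_of_eq ?_); push_cast; rfl
    have e2 : (((B ^ 2) / s : ℕ) : ℝ) ≤ (B:ℝ) ^ 2 / s := by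
      refine Nat.cast_div_le.trans (le_of_eq ?_); push_cast; rfl
    have e3 : 1 ≤ (B:ℝ) ^ 2 / s := by
      rw [le_div_iff₀ hsR]; rw [one_mul]; exact_mod_cast hsN
    calc (Jr p m m' (B ^ 2) : ℝ)
        ≤ (2 * ((2 * s * (B ^ 2) / p : ℕ) : ℝ) + 1) * (2 * (((B ^ 2) / s : ℕ) : ℝ) + 2) := by
          exact_mod_cast hmain
      _ ≤ (2 * (2 * s * (B:ℝ) ^ 2 / p) + 1) * (2 * ((B:ℝ) ^ 2 / s) + 2 * ((B:ℝ) ^ 2 / s)) := by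
          gcongr; linarith
      _ = _ := by field_simp; ring
  refine hmainR.trans ?_
  by_cases hsB : s ≤ B
  · have hk : B / s ≤ Jr p m m' B := by
      have : (Finset.Icc 1 (B / s)).card = B / s := by simp
      rw [← this]
      unfold Jr
      have hz : u1 ≠ 0 ∧ u2 ≠ 0 := by
        have key : ∀ x y : ℤ, x = 0 → |y| < p → ∀ c d : ZMod p, d ≠ 0 →
            (x : ZMod p) * c = (y : ZMod p) * d → y = 0 := by
          intro x y hx hy c d hd h
          rw [hx] at h
          simp only [Int.cast_zero, zero_mul] at h
          have h' : (y : ZMod p) = 0 := (mul_eq_zero.1 h.symm).resolve_right hd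
          rw [ZMod.intCast_zmod_eq_zero_iff_dvd] at h'
          exact Int.eq_zero_of_abs_lt_dvd h' hy
        constructor
        · intro h
          have := key u1 u2 h (by rw [Int.abs_eq_natAbs]; omega) m m' hm' hu
          tauto
        · intro h
          have := key u2 u1 h (by rw [Int.abs_eq_natAbs]; omega) m' m hm hu.symm
          tauto
      have hle : ∀ t : ℕ, t ≤ B / s → ∀ x : ℤ, |x| ≤ s → |(t:ℤ) * x| ≤ B := by
        intro t ht x hx
        rw [abs_mul, Nat.abs_cast]
        have : t * s ≤ B := (Nat.le_div_iff_mul_le hs0).1 ht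
        calc (t:ℤ) * |x| ≤ t * s := by gcongr
          _ ≤ B := by exact_mod_cast this
      apply Finset.card_le_card_of_injOn (fun t : ℕ => ((t:ℤ) * u1, (t:ℤ) * u2))
      · intro t ht
        simp only [coe_Icc, Set.mem_Icc] at ht
        have ht0 : (t:ℤ) ≠ 0 := by omega
        simp only [coe_filter, mem_product, Set.mem_ofPred_eq, mem_nzI]
        refine ⟨⟨⟨mul_ne_zero ht0 hz.1, hle t ht.2 _ (by rw [Int.abs_eq_natAbs]; omega)⟩,
          ⟨mul_ne_zero ht0 hz.2, hle t ht.2 _ (by rw [Int.abs_eq_natAbs]; omega)⟩⟩, ?_⟩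
        push_cast
        linear_combination (t : ZMod p) * hu
      · intro t _ t' _ h
        simp only [Prod.mk.injEq] at h
        have := mul_right_cancel₀ hz.1 h.1
        exact_mod_cast this
    have h1 : (B:ℝ) / s ≤ 2 * Jr p m m' B := by
      have h2 : B ≤ 2 * (B / s) * s := by
        have := Nat.lt_mul_div_succ B hs0
        have h3 : 1 ≤ B / s := (Nat.one_le_div_iff hs0).2 hsB
        nlinarith
      have h4 : B ≤ 2 * (Jr p m m' B) * s := h2.trans (by gcongr)
      rw [div_le_iff₀ hsR]
      exact_mod_cast h4
    have h2 : 4 * (B:ℝ) ^ 2 / s = 4 * B * (B / s) := by ring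
    have h3 : 4 * (B:ℝ) * (B / s) ≤ 4 * B * (2 * Jr p m m' B) := by gcongr
    have : (0:ℝ) ≤ B := by positivity
    rw [h2]; nlinarith
  · have h1 : 4 * (B:ℝ) ^ 2 / s ≤ 4 * B := by
      rw [div_le_iff₀ hsR]
      have : (B:ℝ) ≤ s := by exact_mod_cast (not_le.1 hsB).le
      nlinarith [(Nat.cast_nonneg B : (0:ℝ) ≤ B)]
    have : (0:ℝ) ≤ 8 * B * Jr p m m' B := by positivity
    linarith

/-- Total number of solutions. -/
noncomputable def JJ (p : ℕ) (M : Finset (ZMod p)) (N : ℕ) : ℕ :=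
  ∑ m ∈ M, ∑ m' ∈ M, Jr p m m' N

lemma JJ_step (p : ℕ) [Fact p.Prime] (M : Finset (ZMod p)) (B D : ℕ) (hBp : B < p)
    (hD : ∀ n : ℤ, n ≠ 0 → |n| ≤ (B ^ 2 : ℕ) →
      ((nzI B ×ˢ nzI B).filter (fun x => x.1 * x.2 = n)).card ≤ D) (m' m'' : ZMod p) :
    ∑ m ∈ M, Jr p m m' B * Jr p m m'' B ≤ D ^ 2 * Jr p m' m'' (B ^ 2) := by
  classical
  set Q := nzI B ×ˢ nzI B with hQ
  set S := (Q ×ˢ Q).filter (fun z : (ℤ × ℤ) × (ℤ × ℤ) =>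
    ((z.1.2 * z.2.1 : ℤ) : ZMod p) * m' = ((z.2.2 * z.1.1 : ℤ) : ZMod p) * m'') with hS
  have h1 : ∑ m ∈ M, Jr p m m' B * Jr p m m'' B ≤ S.card := by
    have e : ∀ m ∈ M, Jr p m m' B * Jr p m m'' B =
        ((Q.filter (fun x => (x.1 : ZMod p) * m = (x.2 : ZMod p) * m')) ×ˢ
          (Q.filter (fun x => (x.1 : ZMod p) * m = (x.2 : ZMod p) * m''))).card := by
      intro m _; rw [card_product]; rfl
    rw [Finset.sum_congr rfl e, ← Finset.card_sigma]
    apply Finset.card_le_card_of_injOn (fun w => w.2)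
    · intro w hw
      simp only [coe_sigma, Set.mem_sigma_iff, mem_coe, mem_product, mem_filter] at hw
      obtain ⟨_, ⟨hx, hx'⟩, hy, hy'⟩ := hw
      simp only [hS, mem_coe, mem_filter, mem_product]
      refine ⟨⟨hx, hy⟩, ?_⟩
      push_cast
      linear_combination (-(w.2.2.1 : ZMod p)) * hx' + (w.2.1.1 : ZMod p) * hy'
    · intro w hw w' hw' h
      simp only [coe_sigma, Set.mem_sigma_iff, mem_coe, mem_product, mem_filter] at hw hw'
      obtain ⟨m, x, y⟩ := w
      obtain ⟨n, x', y'⟩ := w'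
      simp only [Prod.mk.injEq] at h
      obtain ⟨rfl, rfl⟩ := h
      simp only at hw hw'
      have hx1 : (x.1 : ZMod p) ≠ 0 := by
        intro h0
        rw [ZMod.intCast_zmod_eq_zero_iff_dvd] at h0
        have hx := hw.2.1.1
        rw [hQ, mem_product, mem_nzI] at hx
        exact hx.1.1 (Int.eq_zero_of_abs_lt_dvd h0 (hx.1.2.trans_lt (by exact_mod_cast hBp)))
      have : m = n := mul_left_cancel₀ hx1 (hw.2.1.2.trans hw'.2.1.2.symm)
      rw [this]
  refine h1.trans ?_
  unfold Jr
  apply Finset.card_le_mul_card_image_of_maps_to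
    (f := fun z : (ℤ × ℤ) × (ℤ × ℤ) => (z.1.2 * z.2.1, z.2.2 * z.1.1))
  · intro z hz
    simp only [hS, hQ, mem_filter, mem_product, mem_nzI] at hz
    obtain ⟨⟨⟨a, b⟩, c, d⟩, e⟩ := hz
    simp only [mem_filter, mem_product, mem_nzI]
    have key : ∀ x y : ℤ, |x| ≤ B → |y| ≤ B → |x * y| ≤ (B ^ 2 : ℕ) := by
      intro x y hx hy
      rw [abs_mul]; push_cast
      calc |x| * |y| ≤ B * B := by gcongr
        _ = _ := by ring
    exact ⟨⟨⟨mul_ne_zero b.1 c.1, key _ _ b.2 c.2⟩, mul_ne_zero d.1 a.1, key _ _ d.2 a.2⟩, e⟩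
  · intro n hn
    simp only [mem_filter, mem_product, mem_nzI] at hn
    calc _ ≤ ((Q.filter (fun x => x.1 * x.2 = n.1)) ×ˢ (Q.filter (fun x => x.1 * x.2 = n.2))).card := by
          apply Finset.card_le_card_of_injOn
            (fun z : (ℤ × ℤ) × (ℤ × ℤ) => ((z.1.2, z.2.1), (z.2.2, z.1.1)))
          · intro z hz
            simp only [hS, hQ, mem_coe, mem_filter, mem_product] at hz
            simp only [hQ, mem_coe, mem_filter, mem_product]
            have := Prod.ext_iff.1 hz.2
            tauto
          · intro z _ w _ h
            simp only [Prod.mk.injEq] at h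
            exact Prod.ext (Prod.ext h.2.2 h.1.1) (Prod.ext h.1.2 h.2.1)
      _ ≤ D * D := by
          rw [card_product]
          exact Nat.mul_le_mul (hD _ hn.1.1.1 hn.1.1.2) (hD _ hn.1.2.1 hn.1.2.2)
      _ = D ^ 2 := by ring

lemma JJ_cauchy (p : ℕ) [Fact p.Prime] (M : Finset (ZMod p)) (B D : ℕ) (hBp : B < p)
    (hD : ∀ n : ℤ, n ≠ 0 → |n| ≤ (B ^ 2 : ℕ) →
      ((nzI B ×ˢ nzI B).filter (fun x => x.1 * x.2 = n)).card ≤ D) :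
    JJ p M B ^ 2 ≤ M.card * (D ^ 2 * JJ p M (B ^ 2)) := by
  unfold JJ
  calc (∑ m ∈ M, ∑ m' ∈ M, Jr p m m' B) ^ 2
      ≤ M.card * ∑ m ∈ M, (∑ m' ∈ M, Jr p m m' B) ^ 2 := sq_sum_le_card_mul_sum_sq
    _ = M.card * ∑ m' ∈ M, ∑ m'' ∈ M, ∑ m ∈ M, Jr p m m' B * Jr p m m'' B := by
        congr 1
        simp_rw [sq, Finset.sum_mul_sum]
        rw [Finset.sum_comm]
        refine Finset.sum_congr rfl fun m' _ => ?_
        rw [Finset.sum_comm]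
    _ ≤ M.card * ∑ m' ∈ M, ∑ m'' ∈ M, D ^ 2 * Jr p m' m'' (B ^ 2) := by
        gcongr with m' _ m'' _
        exact JJ_step p M B D hBp hD m' m''
    _ = _ := by simp_rw [Finset.mul_sum]

lemma JJ_bound (p : ℕ) [Fact p.Prime] (M : Finset (ZMod p)) (hM : ∀ m ∈ M, m ≠ 0)
    (B D : ℕ) (hBp : B < p)
    (hD : ∀ n : ℤ, n ≠ 0 → |n| ≤ (B ^ 2 : ℕ) →
      ((nzI B ×ˢ nzI B).filter (fun x => x.1 * x.2 = n)).card ≤ D) :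
    (JJ p M B : ℝ) ^ 2 ≤ M.card * (D:ℝ) ^ 2 *
      (16 * (M.card:ℝ) ^ 2 * (B:ℝ) ^ 4 / p + 8 * B * JJ p M B + 4 * (M.card:ℝ) ^ 2 * B) := by
  have h1 : (JJ p M B : ℝ) ^ 2 ≤ M.card * ((D:ℝ) ^ 2 * JJ p M (B ^ 2)) := by
    exact_mod_cast JJ_cauchy p M B D hBp hD
  have h2 : (JJ p M (B ^ 2) : ℝ) ≤
      16 * (M.card:ℝ) ^ 2 * (B:ℝ) ^ 4 / p + 8 * B * JJ p M B + 4 * (M.card:ℝ) ^ 2 * B := by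
    unfold JJ
    push_cast
    calc _ ≤ ∑ m ∈ M, ∑ m' ∈ M, (16 * (B:ℝ) ^ 4 / p + 8 * B * Jr p m m' B + 4 * B) := by
          gcongr with m hm m' hm'
          exact lattice_bound p m m' (hM m hm) (hM m' hm') B hBp
      _ = _ := by
          simp only [Finset.sum_add_distrib, Finset.sum_const, ← Finset.mul_sum, nsmul_eq_mul]
          ring
  rw [mul_assoc]
  exact h1.trans (by gcongr)

/-- The linear exponential sum over `{1, …, L}`. -/
noncomputable def DK (p : ℕ) [NeZero p] (L : ℕ) (u : ZMod p) : ℂ :=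
  ∑ x ∈ Finset.Icc 1 L, ZMod.stdAddChar (u * (x : ZMod p))

lemma norm_std (p : ℕ) [NeZero p] (u : ZMod p) : ‖(ZMod.stdAddChar u : ℂ)‖ = 1 := by
  rw [ZMod.stdAddChar_apply]; exact Circle.norm_coe _

lemma DK_le (p : ℕ) [NeZero p] (L : ℕ) (u : ZMod p) : ‖DK p L u‖ ≤ L := by
  unfold DK
  refine (norm_sum_le _ _).trans ?_
  simp

lemma DK_bound (p : ℕ) [NeZero p] (L : ℕ) (u : ZMod p) :
    ‖DK p L u‖ * (2 * |(u.valMinAbs : ℝ)|) ≤ p := by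
  have hp : (0:ℝ) < p := by exact_mod_cast Nat.pos_of_ne_zero (NeZero.ne p)
  set k := u.valMinAbs with hk
  have hu : ((k : ℤ) : ZMod p) = u := ZMod.coe_valMinAbs u
  set z : ℂ := ZMod.stdAddChar u with hz
  have hD : DK p L u * (z - 1) = z * (z ^ L - 1) := by
    clear_value k
    induction L with
    | zero => simp [DK]
    | succ n ih =>
      have h1 : DK p (n + 1) u = DK p n u + z ^ (n + 1) := by
        unfold DK
        rw [Finset.sum_Icc_succ_top (by omega), hz, ← AddChar.map_nsmul_eq_pow, nsmul_eq_mul, mul_comm u ((n+1 : ℕ) : ZMod p)]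
      rw [h1, add_mul, ih]; ring
  have hz1 : ‖z‖ = 1 := norm_std p u
  have hup : ‖DK p L u‖ * ‖z - 1‖ ≤ 2 := by
    rw [← norm_mul, hD, norm_mul, hz1, one_mul]
    refine (norm_sub_le _ _).trans ?_
    rw [norm_pow, hz1]; norm_num
  have hlow : 4 * |(k:ℝ)| / p ≤ ‖z - 1‖ := by
    have e : z = Complex.exp (Complex.I * ((2 * Real.pi * k / p : ℝ) : ℂ)) := by
      rw [hz, ← hu, ZMod.stdAddChar_coe]
      congr 1
      push_cast; ring
    rw [e, Complex.norm_exp_I_mul_ofReal_sub_one, norm_mul]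
    have hkp : |(k:ℝ)| ≤ p / 2 := by
      have := ZMod.natAbs_valMinAbs_le u
      rw [← hk] at this
      have h2 : (k.natAbs : ℝ) ≤ p / 2 := by
        calc (k.natAbs : ℝ) ≤ ((p / 2 : ℕ) : ℝ) := by exact_mod_cast this
          _ ≤ p / 2 := by exact_mod_cast Nat.cast_div_le
      rwa [Nat.cast_natAbs, Int.cast_abs] at h2
    have hx : |2 * Real.pi * k / p / 2| = Real.pi * |(k:ℝ)| / p := by
      have : 2 * Real.pi * k / p / 2 = Real.pi * k / p := by ring
      rw [this, abs_div, abs_mul, abs_of_pos Real.pi_pos, abs_of_pos hp]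
    have hle : |2 * Real.pi * k / p / 2| ≤ Real.pi / 2 := by
      rw [hx, div_le_iff₀ hp]
      nlinarith [Real.pi_pos]
    have := Real.mul_abs_le_abs_sin hle
    rw [hx] at this
    rw [Real.norm_eq_abs, Real.norm_eq_abs, abs_of_pos (by norm_num : (0:ℝ) < 2)]
    calc 4 * |(k:ℝ)| / p = 2 * (2 / Real.pi * (Real.pi * |(k:ℝ)| / p)) := by
          field_simp; ring
      _ ≤ _ := by gcongr
  have h3 : ‖DK p L u‖ * (4 * |(k:ℝ)| / p) ≤ 2 :=
    (mul_le_mul_of_nonneg_left hlow (norm_nonneg _)).trans hup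
  have h4 : ‖DK p L u‖ * (4 * |(k:ℝ)| / p) = (‖DK p L u‖ * (2 * |(k:ℝ)|)) * 2 / p := by ring
  rw [h4, div_le_iff₀ hp] at h3
  linarith

lemma sum_std (p : ℕ) [Fact p.Prime] (b : ZMod p) :
    ∑ t : ZMod p, (ZMod.stdAddChar (t * b) : ℂ) = if b = 0 then (p:ℂ) else 0 := by
  have := AddChar.sum_mulShift b (ZMod.isPrimitive_stdAddChar p)
  rw [this, ZMod.card]
  split_ifs <;> simp

lemma DK_pow (p : ℕ) [NeZero p] (L j : ℕ) (u : ZMod p) :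
    DK p L u ^ j = ∑ x ∈ Fintype.piFinset (fun _ : Fin j => Finset.Icc 1 L),
      (ZMod.stdAddChar (u * ((∑ i, x i : ℕ) : ZMod p)) : ℂ) := by
  have : DK p L u ^ j = ∏ _i : Fin j, DK p L u := by simp
  rw [this]
  unfold DK
  rw [Finset.prod_univ_sum]
  refine Finset.sum_congr rfl fun x _ => ?_
  push_cast
  rw [Finset.mul_sum]
  have h : ∀ s : Finset (Fin j), ∏ i ∈ s, (ZMod.stdAddChar (u * (x i : ZMod p)) : ℂ) =
      ZMod.stdAddChar (∑ i ∈ s, u * (x i : ZMod p)) := by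
    intro s
    induction s using Finset.induction_on with
    | empty => simp
    | insert a s ha ih =>
      rw [Finset.prod_insert ha, Finset.sum_insert ha, AddChar.map_add_eq_mul, ih]
  exact h _

lemma fourier_vanish (p : ℕ) [Fact p.Prime] (M E : Finset (ZMod p)) (H L j : ℕ) (hj : 1 ≤ j)
    (hL : j * L ≤ H)
    (hE : ∀ h ∈ Finset.Icc 1 H, ∀ m ∈ M, (h : ZMod p) * m ∉ E) :
    ∑ t : ZMod p, (∑ m ∈ M, DK p L (t * m) ^ j) * (∑ e ∈ E, (ZMod.stdAddChar (t * -e) : ℂ)) = 0 := by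
  simp_rw [DK_pow, Finset.sum_mul_sum, Finset.sum_mul]
  rw [Finset.sum_comm]
  refine Finset.sum_eq_zero fun m hm => ?_
  rw [Finset.sum_comm]
  refine Finset.sum_eq_zero fun e he => ?_
  rw [Finset.sum_comm]
  refine Finset.sum_eq_zero fun x hx => ?_
  have : ∀ t : ZMod p, (ZMod.stdAddChar (t * m * ((∑ i, x i : ℕ) : ZMod p)) : ℂ) *
      ZMod.stdAddChar (t * -e) = ZMod.stdAddChar (t * (((∑ i, x i : ℕ) : ZMod p) * m - e)) := by
    intro t
    rw [← AddChar.map_add_eq_mul]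
    congr 1; ring
  rw [Finset.sum_congr rfl fun t _ => this t, sum_std, if_neg]
  intro h0
  rw [Fintype.mem_piFinset] at hx
  simp only [Finset.mem_Icc] at hx
  apply hE (∑ i, x i) _ m hm
  · rw [sub_eq_zero.1 h0]; exact he
  · rw [Finset.mem_Icc]
    constructor
    · calc 1 ≤ x ⟨0, hj⟩ := (hx _).1
        _ ≤ _ := Finset.single_le_sum (fun _ _ => Nat.zero_le _) (Finset.mem_univ _)
    · refine le_trans ?_ hL
      calc _ ≤ ∑ _i : Fin j, L := Finset.sum_le_sum fun i _ => (hx i).2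
        _ = _ := by simp

lemma parseval_E (p : ℕ) [Fact p.Prime] (E : Finset (ZMod p)) :
    ∑ t : ZMod p, ‖∑ e ∈ E, (ZMod.stdAddChar (t * -e) : ℂ)‖ ^ 2 = p * E.card := by
  have : ((∑ t : ZMod p, ‖∑ e ∈ E, (ZMod.stdAddChar (t * -e) : ℂ)‖ ^ 2 : ℝ) : ℂ) = p * E.card := by
    push_cast
    have h : ∀ t : ZMod p, ((‖∑ e ∈ E, (ZMod.stdAddChar (t * -e) : ℂ)‖ : ℂ)) ^ 2 =
        ∑ e ∈ E, ∑ e' ∈ E, (ZMod.stdAddChar (t * (e' - e)) : ℂ) := by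
      intro t
      rw [← Complex.mul_conj', map_sum, Finset.sum_mul_sum]
      refine Finset.sum_congr rfl fun e _ => Finset.sum_congr rfl fun e' _ => ?_
      rw [← AddChar.map_neg_eq_conj, ← AddChar.map_add_eq_mul]
      congr 1; ring
    simp_rw [h]
    rw [Finset.sum_comm]
    calc _ = ∑ e ∈ E, ∑ e' ∈ E, if e' = e then (p:ℂ) else 0 := by
          refine Finset.sum_congr rfl fun e _ => ?_
          rw [Finset.sum_comm]
          refine Finset.sum_congr rfl fun e' _ => ?_
          rw [sum_std]
          simp [sub_eq_zero]
      _ = _ := by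
          simp; ring
  exact_mod_cast this

lemma fourier_bound (p : ℕ) [Fact p.Prime] (M E : Finset (ZMod p)) (H L j : ℕ) (hj : 1 ≤ j)
    (hL : j * L ≤ H)
    (hE : ∀ h ∈ Finset.Icc 1 H, ∀ m ∈ M, (h : ZMod p) * m ∉ E) :
    (E.card : ℝ) * (M.card:ℝ) ^ 2 * (L:ℝ) ^ (2 * j) ≤
      p * ∑ t ∈ Finset.univ.erase (0 : ZMod p), (∑ m ∈ M, ‖DK p L (t * m)‖ ^ j) ^ 2 := by
  have h0 := fourier_vanish p M E H L j hj hL hE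
  rw [← Finset.add_sum_erase _ _ (Finset.mem_univ (0 : ZMod p))] at h0
  have hz : (∑ m ∈ M, DK p L (0 * m) ^ j) * (∑ e ∈ E, (ZMod.stdAddChar (0 * -e) : ℂ)) =
      ((M.card * (L:ℝ) ^ j * E.card : ℝ) : ℂ) := by
    simp [DK]
  rw [hz] at h0
  set R := ∑ t ∈ Finset.univ.erase (0 : ZMod p), (∑ m ∈ M, ‖DK p L (t * m)‖ ^ j) ^ 2 with hR
  have h1 : (M.card * (L:ℝ) ^ j * E.card : ℝ) ≤ ∑ t ∈ Finset.univ.erase (0 : ZMod p),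
      (∑ m ∈ M, ‖DK p L (t * m)‖ ^ j) * ‖∑ e ∈ E, (ZMod.stdAddChar (t * -e) : ℂ)‖ := by
    have h2 := eq_neg_of_add_eq_zero_left h0
    have h3 := congrArg norm h2
    rw [norm_neg, Complex.norm_real, Real.norm_of_nonneg (by positivity)] at h3
    rw [h3]
    refine (norm_sum_le _ _).trans (Finset.sum_le_sum fun t _ => ?_)
    rw [norm_mul]
    gcongr
    refine (norm_sum_le _ _).trans (le_of_eq ?_)
    simp [norm_pow]
  have h2 : (M.card * (L:ℝ) ^ j * E.card : ℝ) ^ 2 ≤ R * (p * E.card) := by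
    calc _ ≤ (∑ t ∈ Finset.univ.erase (0 : ZMod p),
      (∑ m ∈ M, ‖DK p L (t * m)‖ ^ j) * ‖∑ e ∈ E, (ZMod.stdAddChar (t * -e) : ℂ)‖) ^ 2 := by
          gcongr
      _ ≤ R * ∑ t ∈ Finset.univ.erase (0 : ZMod p), ‖∑ e ∈ E, (ZMod.stdAddChar (t * -e) : ℂ)‖ ^ 2 :=
          Finset.sum_mul_sq_le_sq_mul_sq _ _ _
      _ ≤ R * (p * E.card) := by
          rw [← parseval_E]
          have : 0 ≤ R := Finset.sum_nonneg fun _ _ => sq_nonneg _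
          gcongr
          exact Finset.erase_subset _ _
  have hR0 : 0 ≤ R := Finset.sum_nonneg fun _ _ => sq_nonneg _
  rcases Nat.eq_zero_or_pos E.card with h | h
  · rw [h]; simp; positivity
  · have hEp : (0:ℝ) < E.card := by exact_mod_cast h
    have h5 : (E.card:ℝ) * ((E.card : ℝ) * (M.card:ℝ) ^ 2 * (L:ℝ) ^ (2 * j)) ≤ E.card * (p * R) := by
      calc _ = (M.card * (L:ℝ) ^ j * E.card : ℝ) ^ 2 := by ring
        _ ≤ _ := h2
        _ = _ := by ring
    exact le_of_mul_le_mul_left h5 hEp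

lemma count_bound (p : ℕ) [Fact p.Prime] (M : Finset (ZMod p)) (hM : ∀ m ∈ M, m ≠ 0) (B : ℕ) :
    ∑ t ∈ Finset.univ.erase (0 : ZMod p),
      (M.filter (fun m => |(t * m).valMinAbs| ≤ B)).card ^ 2 ≤ JJ p M B := by
  classical
  have h1 : ∀ t : ZMod p, (M.filter (fun m => |(t * m).valMinAbs| ≤ B)).card ^ 2 =
      ∑ m ∈ M, ∑ m' ∈ M, if |(t * m').valMinAbs| ≤ B ∧ |(t * m).valMinAbs| ≤ B then 1 else 0 := by
    intro t
    rw [sq, Finset.card_filter, Finset.sum_mul_sum]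
    refine Finset.sum_congr rfl fun m _ => Finset.sum_congr rfl fun m' _ => ?_
    split_ifs <;> simp_all
  simp_rw [h1]
  rw [Finset.sum_comm]
  unfold JJ
  refine Finset.sum_le_sum fun m hm => ?_
  rw [Finset.sum_comm]
  refine Finset.sum_le_sum fun m' hm' => ?_
  rw [← Finset.card_filter]
  unfold Jr
  apply Finset.card_le_card_of_injOn
    (fun t : ZMod p => ((t * m').valMinAbs, (t * m).valMinAbs))
  · intro t ht
    simp only [coe_filter, Set.mem_ofPred_eq, mem_erase] at ht
    simp only [coe_filter, mem_product, mem_nzI, Set.mem_ofPred_eq, ZMod.coe_valMinAbs]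
    refine ⟨⟨⟨?_, ht.2.1⟩, ?_, ht.2.2⟩, by ring⟩
    · rw [Ne, ZMod.valMinAbs_eq_zero]; exact mul_ne_zero ht.1.1 (hM _ hm')
    · rw [Ne, ZMod.valMinAbs_eq_zero]; exact mul_ne_zero ht.1.1 (hM _ hm)
  · intro t _ t' _ h
    simp only [Prod.mk.injEq] at h
    exact mul_right_cancel₀ (hM _ hm') (ZMod.injective_valMinAbs h.1)

lemma E_bound (p : ℕ) [Fact p.Prime] (M E : Finset (ZMod p)) (hM : ∀ m ∈ M, m ≠ 0)
    (H L j B : ℕ) (hj : 1 ≤ j) (hB : 1 ≤ B)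
    (hL : j * L ≤ H)
    (hE : ∀ h ∈ Finset.Icc 1 H, ∀ m ∈ M, (h : ZMod p) * m ∉ E) :
    (E.card : ℝ) * (M.card:ℝ) ^ 2 * (L:ℝ) ^ (2 * j) ≤
      p * (2 * (L:ℝ) ^ (2 * j) * JJ p M B + 2 * p * (M.card:ℝ) ^ 2 * ((p:ℝ) / (2 * B)) ^ (2 * j)) := by
  classical
  have hBR : (1:ℝ) ≤ B := by exact_mod_cast hB
  refine (fourier_bound p M E H L j hj hL hE).trans ?_
  gcongr
  set T : ℝ := ((p:ℝ) / (2 * B)) ^ j with hT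
  have hT0 : 0 ≤ T := by positivity
  set c : ZMod p → ℕ := fun t => (M.filter (fun m => |(t * m).valMinAbs| ≤ B)).card with hc
  have h1 : ∀ t : ZMod p, ∑ m ∈ M, ‖DK p L (t * m)‖ ^ j ≤ (L:ℝ) ^ j * c t + M.card * T := by
    intro t
    calc _ ≤ ∑ m ∈ M, ((L:ℝ) ^ j * (if |(t * m).valMinAbs| ≤ B then 1 else 0) + T) := by
          refine Finset.sum_le_sum fun m _ => ?_
          split_ifs with h
          · have : ‖DK p L (t * m)‖ ^ j ≤ (L:ℝ) ^ j := by gcongr; exact DK_le _ _ _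
            linarith
          · have h2 := DK_bound p L (t * m)
            have h3 : (B:ℝ) ≤ |((t * m).valMinAbs : ℝ)| := by
              have := (not_le.1 h).le
              exact_mod_cast this
            have h4 : ‖DK p L (t * m)‖ ≤ (p:ℝ) / (2 * B) := by
              rw [le_div_iff₀ (by positivity)]
              refine le_trans ?_ h2
              gcongr
            have : ‖DK p L (t * m)‖ ^ j ≤ T := by rw [hT]; gcongr
            linarith
      _ = _ := by
          rw [Finset.sum_add_distrib, ← Finset.mul_sum, hc]
          simp
  calc _ ≤ ∑ t ∈ Finset.univ.erase (0 : ZMod p),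
          (2 * (L:ℝ) ^ (2 * j) * ((c t ^ 2 : ℕ) : ℝ) + 2 * (M.card:ℝ) ^ 2 * T ^ 2) := by
        refine Finset.sum_le_sum fun t _ => ?_
        have h2 := h1 t
        have h3 : (∑ m ∈ M, ‖DK p L (t * m)‖ ^ j) ^ 2 ≤ ((L:ℝ) ^ j * c t + M.card * T) ^ 2 := by
          have : 0 ≤ ∑ m ∈ M, ‖DK p L (t * m)‖ ^ j := Finset.sum_nonneg fun _ _ => by positivity
          gcongr
        refine h3.trans ?_
        push_cast
        have : (L:ℝ) ^ (2 * j) = ((L:ℝ) ^ j) ^ 2 := by ring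
        rw [this]
        nlinarith [sq_nonneg ((L:ℝ) ^ j * c t - M.card * T)]
    _ = 2 * (L:ℝ) ^ (2 * j) * ((∑ t ∈ Finset.univ.erase (0 : ZMod p), c t ^ 2 : ℕ) : ℝ) +
          (Finset.univ.erase (0 : ZMod p)).card * (2 * (M.card:ℝ) ^ 2 * T ^ 2) := by
        rw [Finset.sum_add_distrib, ← Finset.mul_sum, Finset.sum_const, nsmul_eq_mul]
        push_cast; rfl
    _ ≤ 2 * (L:ℝ) ^ (2 * j) * JJ p M B + p * (2 * (M.card:ℝ) ^ 2 * T ^ 2) := by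
        gcongr
        · exact count_bound p M hM B
        · calc _ ≤ (Finset.univ : Finset (ZMod p)).card := Finset.card_le_card (Finset.erase_subset _ _)
            _ = p := by rw [Finset.card_univ, ZMod.card]
    _ = _ := by rw [hT]; ring

lemma rho_bound (C w r : ℝ) (hC : 1 ≤ C) (hw : 0 < w) (hw1 : w ≤ 1)
    (h : r ^ 2 ≤ C * w ^ 2 * (1 + r)) : r ≤ 2 * C * w := by
  by_contra hcon
  have hr : 2 * C * w < r := not_le.1 hcon
  have hCw : 0 < C * w := by positivity
  have hr0 : 0 < r := by nlinarith
  have h1 : C * w * w * r ≤ C * w * 1 * r := by gcongr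
  have h2 : 2 * C * w * r < r * r := by gcongr
  have h3 : C * w * (2 * C * w) < C * w * r := by gcongr
  have h4 : C * w ^ 2 * 1 ≤ C * w ^ 2 * C := by gcongr
  nlinarith [sq_nonneg (C * w)]

lemma rep_real (θ : ℝ) (hθ : 0 < θ) : ∃ C : ℝ, 1 ≤ C ∧ ∀ p B : ℕ, 0 < p → B < p → ∃ D : ℕ,
    (D:ℝ) ^ 2 ≤ C * (p:ℝ) ^ θ ∧ ∀ n : ℤ, n ≠ 0 → |n| ≤ (B ^ 2 : ℕ) →
      ((nzI B ×ˢ nzI B).filter (fun x => x.1 * x.2 = n)).card ≤ D := by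
  obtain ⟨C0, hC0, hdiv⟩ := divisor_bound (θ / 4) (by positivity)
  refine ⟨4 * C0 ^ 2, by nlinarith, fun p B hp hBp => ?_⟩
  have hpR : (0:ℝ) < p := by exact_mod_cast hp
  refine ⟨⌊2 * C0 * (p:ℝ) ^ (θ / 2)⌋₊, ?_, ?_⟩
  · have h1 : (⌊2 * C0 * (p:ℝ) ^ (θ / 2)⌋₊ : ℝ) ≤ 2 * C0 * (p:ℝ) ^ (θ / 2) :=
      Nat.floor_le (by positivity)
    calc _ ≤ (2 * C0 * (p:ℝ) ^ (θ / 2)) ^ 2 := by gcongr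
      _ = 4 * C0 ^ 2 * ((p:ℝ) ^ (θ / 2) * (p:ℝ) ^ (θ / 2)) := by ring
      _ = _ := by rw [← Real.rpow_add hpR]; congr 2; ring
  · intro n hn hnB
    apply Nat.le_floor
    have h1 := rep_card B n hn
    have h2 := hdiv n.natAbs (by simpa using hn)
    have h3 : (n.natAbs : ℝ) ≤ (p:ℝ) ^ (2:ℝ) := by
      have : n.natAbs ≤ p ^ 2 := by
        rw [Int.abs_eq_natAbs] at hnB
        have h4 : n.natAbs ≤ B ^ 2 := by exact_mod_cast hnB
        exact h4.trans (by gcongr)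
      rw [Real.rpow_two]
      exact_mod_cast this
    calc (_ : ℝ) ≤ 2 * (n.natAbs.divisors.card : ℝ) := by exact_mod_cast h1
      _ ≤ 2 * (C0 * ((p:ℝ) ^ (2:ℝ)) ^ (θ / 4)) := by
          refine mul_le_mul_of_nonneg_left (h2.trans ?_) (by norm_num)
          gcongr
      _ = _ := by
          rw [← Real.rpow_mul hpR.le]
          have : 2 * (θ / 4) = θ / 2 := by ring
          rw [this]; ring

set_option maxHeartbeats 4000000 in
lemma core (θ : ℝ) (hθ : 0 < θ) : ∃ C P0 : ℝ, 0 < C ∧ 0 < P0 ∧ ∀ p : ℕ, p.Prime → P0 ≤ p →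
    ∀ H : ℕ, 1 ≤ H → H ≤ p → ∀ M E : Finset (ZMod p), (∀ m ∈ M, m ≠ 0) →
    (p:ℝ) ^ (1 + 32 * θ) ≤ (H:ℝ) * M.card → (p:ℝ) ^ (3 + 32 * θ) ≤ (H:ℝ) ^ 4 * M.card →
    (∀ h ∈ Finset.Icc 1 H, ∀ m ∈ M, (h : ZMod p) * m ∉ E) →
    (E.card : ℝ) ≤ C * (p:ℝ) ^ (1 - 11 * θ) + 2 := by
  obtain ⟨C0, hC0, hrep⟩ := rep_real θ hθ
  set j : ℕ := ⌈1 / θ⌉₊ + 1 with hj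
  have hj1 : 1 ≤ j := by omega
  have hjθ : 1 ≤ θ * j := by
    have h1 : 1 / θ ≤ j := (Nat.le_ceil _).trans (by rw [hj]; push_cast; linarith)
    rw [div_le_iff₀ hθ] at h1
    linarith
  refine ⟨4 * (C0 * 264), max 5 (max ((j:ℝ) ^ 2) ((j:ℝ) ^ (1 / θ))), by positivity, by positivity, ?_⟩
  intro p hp hP0 H hH1 hHp M E hM hHM hHM4 hE
  haveI : Fact p.Prime := ⟨hp⟩
  have hp5 : (5:ℝ) ≤ p := (le_max_left _ _).trans hP0
  have hpj2 : (j:ℝ) ^ 2 ≤ p := (le_max_left _ _).trans ((le_max_right _ _).trans hP0)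
  have hpjθ : (j:ℝ) ≤ (p:ℝ) ^ θ := by
    have h1 : (j:ℝ) ^ (1 / θ) ≤ p := (le_max_right _ _).trans ((le_max_right _ _).trans hP0)
    have h2 := Real.rpow_le_rpow (by positivity) h1 hθ.le
    rwa [← Real.rpow_mul (by positivity), one_div_mul_cancel hθ.ne', Real.rpow_one] at h2
  have hpR : (0:ℝ) < p := by linarith
  have hp1 : (1:ℝ) ≤ p := by linarith
  have hHR : (1:ℝ) ≤ H := by exact_mod_cast hH1
  have hH0 : (0:ℝ) < H := by linarith
  have hHpR : (H:ℝ) ≤ p := by exact_mod_cast hHp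
  have hM0 : (0:ℝ) < M.card := by
    have : 0 < (H:ℝ) * M.card := lt_of_lt_of_le (by positivity) hHM
    exact pos_of_mul_pos_right this hH0.le
  have hMp : (M.card:ℝ) ≤ p := by
    have : M.card ≤ p := by
      have := Finset.card_le_univ M
      rwa [ZMod.card] at this
    exact_mod_cast this
  -- H is large
  have hH4 : (p:ℝ) ^ (2 + 32 * θ) ≤ (H:ℝ) ^ 4 := by
    have h1 : (p:ℝ) ^ (2 + 32 * θ) * p ≤ (H:ℝ) ^ 4 * p := by
      calc _ = (p:ℝ) ^ (3 + 32 * θ) := by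
            rw [← Real.rpow_add_one hpR.ne']; congr 1; ring
        _ ≤ _ := hHM4
        _ ≤ _ := by gcongr
    exact le_of_mul_le_mul_right h1 hpR
  have hHsq : (p:ℝ) ≤ (H:ℝ) ^ 2 := by
    have h1 : (p:ℝ) ^ 2 ≤ ((H:ℝ) ^ 2) ^ 2 := by
      calc (p:ℝ) ^ 2 = (p:ℝ) ^ (2:ℝ) := by rw [Real.rpow_two]
        _ ≤ (p:ℝ) ^ (2 + 32 * θ) := Real.rpow_le_rpow_of_exponent_le hp1 (by linarith)
        _ ≤ _ := hH4
        _ = _ := by ring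
    exact le_of_sq_le_sq h1 (by positivity)
  have hjH : j ≤ H := by
    have h1 : (j:ℝ) ^ 2 ≤ (H:ℝ) ^ 2 := hpj2.trans hHsq
    have : (j:ℝ) ≤ H := le_of_sq_le_sq h1 hH0.le
    exact_mod_cast this
  -- B
  set X : ℝ := (p:ℝ) ^ (1 + 2 * θ) / H with hX
  have hX1 : 1 ≤ X := by
    rw [hX, le_div_iff₀ hH0, one_mul]
    calc (H:ℝ) ≤ (p:ℝ) ^ (1:ℝ) := by rw [Real.rpow_one]; exact hHpR
      _ ≤ _ := Real.rpow_le_rpow_of_exponent_le hp1 (by linarith)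
  set B : ℕ := ⌈X⌉₊ with hB
  have hXB : X ≤ B := Nat.le_ceil _
  have hBX : (B:ℝ) ≤ 2 * X := by
    have := Nat.ceil_lt_add_one (by linarith : 0 ≤ X)
    linarith
  have hB1R : (1:ℝ) ≤ B := hX1.trans hXB
  have hB1 : 1 ≤ B := by exact_mod_cast hB1R
  have hX4 : X ^ 4 * (H:ℝ) ^ 4 = (p:ℝ) ^ (4 + 8 * θ) := by
    rw [hX, div_pow, div_mul_cancel₀ _ (by positivity), ← Real.rpow_natCast, ← Real.rpow_mul hpR.le]
    congr 1; push_cast; ring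
  have hBp : B < p := by
    have h1 : X ^ 4 ≤ (p:ℝ) ^ 2 := by
      have h2 : X ^ 4 * (H:ℝ) ^ 4 ≤ (p:ℝ) ^ 2 * (H:ℝ) ^ 4 := by
        rw [hX4]
        calc (p:ℝ) ^ (4 + 8 * θ) ≤ (p:ℝ) ^ (2 + (2 + 32 * θ)) :=
              Real.rpow_le_rpow_of_exponent_le hp1 (by linarith)
          _ = (p:ℝ) ^ 2 * (p:ℝ) ^ (2 + 32 * θ) := by rw [Real.rpow_add hpR, Real.rpow_two]
          _ ≤ _ := by gcongr
      exact le_of_mul_le_mul_right h2 (by positivity)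
    have h2 : X ^ 2 ≤ p := by
      refine le_of_sq_le_sq ?_ hpR.le
      calc (X ^ 2) ^ 2 = X ^ 4 := by ring
        _ ≤ _ := h1
    have h3 : (B:ℝ) ^ 2 < (p:ℝ) ^ 2 := by
      calc (B:ℝ) ^ 2 ≤ (2 * X) ^ 2 := by gcongr
        _ = 4 * X ^ 2 := by ring
        _ ≤ 4 * p := by gcongr
        _ < (p:ℝ) ^ 2 := by nlinarith
    have : (B:ℝ) < p := lt_of_pow_lt_pow_left₀ 2 hpR.le h3
    exact_mod_cast this
  obtain ⟨D, hD2, hD⟩ := hrep p B hp.pos hBp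
  have hJ := JJ_bound p M hM B D hBp hD
  set J : ℝ := (JJ p M B : ℝ) with hJdef
  have hJ0 : 0 ≤ J := by positivity
  set m : ℝ := (M.card : ℝ) with hm
  set y : ℝ := (p:ℝ) ^ (-(24 * θ)) with hy
  have hy0 : 0 < y := by positivity
  have hb1 : (B:ℝ) ≤ 2 * y * m := by
    have h1 : X ≤ y * m := by
      rw [hX, div_le_iff₀ hH0]
      calc (p:ℝ) ^ (1 + 2 * θ) ≤ (p:ℝ) ^ (-(24 * θ) + (1 + 32 * θ)) :=
            Real.rpow_le_rpow_of_exponent_le hp1 (by linarith)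
        _ = y * (p:ℝ) ^ (1 + 32 * θ) := by rw [Real.rpow_add hpR]
        _ ≤ y * (H * m) := by gcongr
        _ = _ := by ring
    linarith
  have hb2 : (B:ℝ) ^ 4 / p ≤ 16 * y * m := by
    rw [div_le_iff₀ hpR]
    have h1 : X ^ 4 ≤ y * m * p := by
      have h2 : X ^ 4 * (H:ℝ) ^ 4 ≤ (y * m * p) * (H:ℝ) ^ 4 := by
        rw [hX4]
        calc (p:ℝ) ^ (4 + 8 * θ) = (p:ℝ) ^ (-(24 * θ) + (3 + 32 * θ) + 1) := by congr 1; ring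
          _ = y * (p:ℝ) ^ (3 + 32 * θ) * p := by
              rw [Real.rpow_add_one hpR.ne', Real.rpow_add hpR]
          _ ≤ y * ((H:ℝ) ^ 4 * m) * p := by gcongr
          _ = _ := by ring
      exact le_of_mul_le_mul_right h2 (by positivity)
    calc (B:ℝ) ^ 4 ≤ (2 * X) ^ 4 := by gcongr
      _ = 16 * X ^ 4 := by ring
      _ ≤ 16 * (y * m * p) := by gcongr
      _ = _ := by ring
  set w : ℝ := (p:ℝ) ^ (-(11 * θ)) with hw
  have hw0 : 0 < w := by positivity
  have hw1 : w ≤ 1 := Real.rpow_le_one_of_one_le_of_nonpos hp1 (by linarith)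
  have hyw : (p:ℝ) ^ θ * y ≤ w ^ 2 := by
    rw [hy, hw, ← Real.rpow_add hpR, ← Real.rpow_natCast, ← Real.rpow_mul hpR.le]
    apply Real.rpow_le_rpow_of_exponent_le hp1
    push_cast; linarith
  have hrho : J / m ^ 2 ≤ 2 * (C0 * 264) * w := by
    apply rho_bound _ _ _ (by linarith) hw0 hw1
    have h1 : J ^ 2 ≤ m * (C0 * (p:ℝ) ^ θ) *
        (16 * m ^ 2 * (16 * y * m) + 8 * (2 * y * m) * J + 4 * m ^ 2 * (2 * y * m)) := by
      refine hJ.trans ?_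
      have h2 : 16 * m ^ 2 * (B:ℝ) ^ 4 / p = 16 * m ^ 2 * ((B:ℝ) ^ 4 / p) := by ring
      rw [h2]
      gcongr
    have h3 : m * (C0 * (p:ℝ) ^ θ) *
        (16 * m ^ 2 * (16 * y * m) + 8 * (2 * y * m) * J + 4 * m ^ 2 * (2 * y * m)) =
        C0 * ((p:ℝ) ^ θ * y) * m ^ 2 * (264 * m ^ 2 + 16 * J) := by ring
    rw [div_pow, div_le_iff₀ (by positivity)]
    calc J ^ 2 ≤ _ := h1
      _ = _ := h3
      _ ≤ C0 * (w ^ 2) * m ^ 2 * (264 * m ^ 2 + 264 * J) := by gcongr; norm_num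
      _ = _ := by field_simp
  -- L
  set L : ℕ := H / j with hL
  have hLH : j * L ≤ H := Nat.mul_div_le H j
  have hL1 : 1 ≤ L := (Nat.one_le_div_iff (by omega)).2 hjH
  have hL2 : (H:ℝ) ≤ 2 * j * L := by
    have h1 : H < j * (L + 1) := Nat.lt_mul_div_succ H (by omega)
    have h2 : H ≤ 2 * j * L := by nlinarith
    exact_mod_cast h2
  have hLR : (0:ℝ) < L := by exact_mod_cast hL1
  have hjR : (0:ℝ) < j := by exact_mod_cast hj1
  have hEb := E_bound p M E hM H L j B hj1 hB1 hLH hE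
  have htail : (p:ℝ) / (2 * B) / L ≤ (p:ℝ) ^ (-θ) := by
    rw [div_div, div_le_iff₀ (by positivity)]
    have h1 : (p:ℝ) ^ (1 + 2 * θ) ≤ B * (2 * j * L) := by
      calc (p:ℝ) ^ (1 + 2 * θ) = X * H := by rw [hX]; field_simp
        _ ≤ _ := by gcongr
    have h2 : (p:ℝ) ^ (1 + 2 * θ) = p * (p:ℝ) ^ θ * (p:ℝ) ^ θ := by
      rw [mul_assoc, ← Real.rpow_add hpR]
      nth_rewrite 2 [← Real.rpow_one (p:ℝ)]
      rw [← Real.rpow_add hpR]; congr 1; ring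
    have hq : 0 < (p:ℝ) ^ θ := by positivity
    rw [Real.rpow_neg hpR.le, inv_mul_eq_div, le_div_iff₀ hq]
    have h3 : p * (p:ℝ) ^ θ * (p:ℝ) ^ θ ≤ (2 * B * L) * (p:ℝ) ^ θ := by
      rw [← h2]
      calc (p:ℝ) ^ (1 + 2 * θ) ≤ (B:ℝ) * (2 * (j:ℝ) * (L:ℝ)) := h1
        _ = 2 * (B:ℝ) * (L:ℝ) * (j:ℝ) := by ring
        _ ≤ _ := by gcongr
    exact le_of_mul_le_mul_right h3 hq
  have htail2 : ((p:ℝ) / (2 * B)) ^ (2 * j) ≤ (L:ℝ) ^ (2 * j) * ((p:ℝ) ^ 2)⁻¹ := by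
    have h1 : ((p:ℝ) / (2 * B) / L) ^ (2 * j) ≤ ((p:ℝ) ^ 2)⁻¹ := by
      calc _ ≤ ((p:ℝ) ^ (-θ)) ^ (2 * j) := by gcongr
        _ = (p:ℝ) ^ (-θ * ((2 * j : ℕ) : ℝ)) := by
            rw [← Real.rpow_natCast, ← Real.rpow_mul hpR.le]
        _ ≤ (p:ℝ) ^ (-2 : ℝ) := by
            apply Real.rpow_le_rpow_of_exponent_le hp1
            push_cast; nlinarith
        _ = _ := by rw [Real.rpow_neg hpR.le, Real.rpow_two]
    rw [div_pow, div_le_iff₀ (by positivity)] at h1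
    linarith
  have hfin : (E.card : ℝ) * (m ^ 2 * (L:ℝ) ^ (2 * j)) ≤
      (2 * p * (J / m ^ 2) + 2) * (m ^ 2 * (L:ℝ) ^ (2 * j)) := by
    calc _ = (E.card : ℝ) * m ^ 2 * (L:ℝ) ^ (2 * j) := by ring
      _ ≤ _ := hEb
      _ ≤ p * (2 * (L:ℝ) ^ (2 * j) * J + 2 * p * m ^ 2 * ((L:ℝ) ^ (2 * j) * ((p:ℝ) ^ 2)⁻¹)) := by
          gcongr
      _ = _ := by field_simp
  have hfin2 := le_of_mul_le_mul_right hfin (by positivity)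
  have hpw : (p:ℝ) ^ (1 - 11 * θ) = p * w := by
    rw [sub_eq_add_neg, Real.rpow_add hpR, Real.rpow_one]
  rw [hpw]
  calc (E.card : ℝ) ≤ _ := hfin2
    _ ≤ 2 * p * (2 * (C0 * 264) * w) + 2 := by gcongr
    _ = _ := by ring

/-- Theorem 1.1 (product of an initial interval and an arbitrary set covers almost all of 𝔽_p). -/
theorem stmt_0 :
    ∀ ε : ℝ, 0 < ε → ∃ η C : ℝ, 0 < η ∧ 0 < C ∧
      ∀ (p : ℕ), p.Prime → ∀ (H : ℕ), 1 ≤ H → H ≤ p →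
      ∀ (M : Finset (ZMod p)), (∀ m ∈ M, m ≠ 0) →
      (((p : ℝ) ^ ((2:ℝ)/3) ≤ (H : ℝ) ∧ (p : ℝ) ^ ((1:ℝ) + ε) ≤ (H : ℝ) * (M.card : ℝ)) ∨
       ((H : ℝ) < (p : ℝ) ^ ((2:ℝ)/3) ∧ (p : ℝ) ^ ((1:ℝ)/3) ≤ (M.card : ℝ) ∧
        (p : ℝ) ^ ((3:ℝ)/4 + ε) ≤ (H : ℝ) * (M.card : ℝ) ^ ((1:ℝ)/4))) →
      |((((Finset.Icc 1 H) ×ˢ M).image (fun q => (q.1 : ZMod p) * q.2)).card : ℝ) - (p : ℝ)| ≤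
        C * (p : ℝ) ^ ((1:ℝ) - η) := by
  intro ε hε
  obtain ⟨C, P0, hC, hP0, hcore⟩ := core (ε / 32) (by positivity)
  refine ⟨min (ε / 32) 1, C + 2 + P0, by positivity, by positivity, ?_⟩
  intro p hp H hH1 hHp M hM hcase
  haveI : Fact p.Prime := ⟨hp⟩
  set η := min (ε / 32) 1 with hη
  have hη1 : η ≤ 1 := min_le_right _ _
  have hη2 : η ≤ ε / 32 := min_le_left _ _
  have hp1 : (1:ℝ) ≤ p := by exact_mod_cast hp.one_lt.le
  have hpR : (0:ℝ) < p := by linarith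
  have hone : 1 ≤ (p:ℝ) ^ (1 - η) := Real.one_le_rpow hp1 (by linarith)
  set A := ((Finset.Icc 1 H) ×ˢ M).image (fun q => (q.1 : ZMod p) * q.2) with hA
  have hAE : (A.card : ℝ) + (Aᶜ.card : ℝ) = p := by
    have := Finset.card_add_card_compl A
    rw [ZMod.card] at this
    exact_mod_cast this
  have habs : |(A.card : ℝ) - p| = (Aᶜ.card : ℝ) := by
    rw [← hAE]
    have : (A.card : ℝ) - (A.card + (Aᶜ.card : ℝ)) = -(Aᶜ.card : ℝ) := by ring
    rw [this, abs_neg, abs_of_nonneg (by positivity)]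
  rw [habs]
  by_cases hbig : P0 ≤ p
  swap
  · have h1 : (Aᶜ.card : ℝ) ≤ p := by
      have : (0:ℝ) ≤ A.card := by positivity
      linarith
    have h2 : (Aᶜ.card : ℝ) ≤ P0 := h1.trans (not_le.1 hbig).le
    calc (Aᶜ.card : ℝ) ≤ P0 * 1 := by linarith
      _ ≤ (C + 2 + P0) * (p:ℝ) ^ (1 - η) := by gcongr; linarith
  have hHR : (1:ℝ) ≤ H := by exact_mod_cast hH1
  have hkey : (p:ℝ) ^ (1 + 32 * (ε / 32)) ≤ (H:ℝ) * M.card ∧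
      (p:ℝ) ^ (3 + 32 * (ε / 32)) ≤ (H:ℝ) ^ 4 * M.card := by
    have he : 32 * (ε / 32) = ε := by ring
    rw [he]
    rcases hcase with ⟨h1, h2⟩ | ⟨h1, h2, h3⟩
    · refine ⟨h2, ?_⟩
      calc (p:ℝ) ^ (3 + ε) = ((p:ℝ) ^ ((2:ℝ)/3)) ^ 3 * (p:ℝ) ^ (1 + ε) := by
            rw [← Real.rpow_natCast, ← Real.rpow_mul hpR.le, ← Real.rpow_add hpR]
            congr 1; push_cast; ring
        _ ≤ (H:ℝ) ^ 3 * (H * M.card) := by gcongr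
        _ = _ := by ring
    · have h4 : (p:ℝ) ^ (3 + 4 * ε) ≤ (H:ℝ) ^ 4 * M.card := by
        calc (p:ℝ) ^ (3 + 4 * ε) = ((p:ℝ) ^ ((3:ℝ)/4 + ε)) ^ 4 := by
              rw [← Real.rpow_natCast, ← Real.rpow_mul hpR.le]
              congr 1; push_cast; ring
          _ ≤ (H * (M.card:ℝ) ^ ((1:ℝ)/4)) ^ 4 := by gcongr
          _ = (H:ℝ) ^ 4 * ((M.card:ℝ) ^ ((1:ℝ)/4)) ^ 4 := by ring
          _ = _ := by
              congr 1
              rw [← Real.rpow_natCast, ← Real.rpow_mul (by positivity)]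
              norm_num
      constructor
      · have h5 : ((p:ℝ) ^ (1 + ε)) ^ 4 ≤ ((H:ℝ) * M.card) ^ 4 := by
          calc ((p:ℝ) ^ (1 + ε)) ^ 4 = (p:ℝ) ^ (3 + 4 * ε) * ((p:ℝ) ^ ((1:ℝ)/3)) ^ 3 := by
                rw [← Real.rpow_natCast, ← Real.rpow_mul hpR.le, ← Real.rpow_natCast,
                  ← Real.rpow_mul hpR.le, ← Real.rpow_add hpR]
                congr 1; push_cast; ring
            _ ≤ ((H:ℝ) ^ 4 * M.card) * (M.card:ℝ) ^ 3 := by gcongr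
            _ = _ := by ring
        exact le_of_pow_le_pow_left₀ (by norm_num) (by positivity) h5
      · exact (Real.rpow_le_rpow_of_exponent_le hp1 (by linarith)).trans h4
  have hmain := hcore p hp hbig H hH1 hHp M Aᶜ hM hkey.1 hkey.2 (by
    intro h hh m hm
    rw [Finset.mem_compl, not_not, hA, Finset.mem_image]
    exact ⟨(h, m), Finset.mem_product.2 ⟨hh, hm⟩, rfl⟩)
  have h1 : (p:ℝ) ^ (1 - 11 * (ε / 32)) ≤ (p:ℝ) ^ (1 - η) :=
    Real.rpow_le_rpow_of_exponent_le hp1 (by linarith)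
  calc (Aᶜ.card : ℝ) ≤ _ := hmain
    _ ≤ C * (p:ℝ) ^ (1 - η) + 2 * (p:ℝ) ^ (1 - η) + P0 * (p:ℝ) ^ (1 - η) := by
        have : 0 ≤ P0 * (p:ℝ) ^ (1 - η) := by positivity
        have := mul_le_mul_of_nonneg_left h1 hC.le
        linarith
    _ = _ := by ring
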